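/- Let p ∈ [1,∞), let P₀ and P be Borel probability measures on ℝ^d, both with finite p-th moment. For an i.i.d. sample X₁,…,Xₙ from P with empirical distribution P̂_n, let T_n = W_p^p(P̂_n, P₀). Then T_n → W_p^p(P, P₀) in Pⁿ-probability as n → ∞, i.e., for every ε > 0, lim_{n→∞} Pⁿ[ |T_n − W_p^p(P,P₀)| > ε ] = 0. -/

import Mathlib

open MeasureTheory ENNReal Filter Topology

noncomputable section

/-- `ℝ^d` as Euclidean space. -/
abbrev Euc (d : ℕ) : Type := EuclideanSpace ℝ (Fin d)

/-- The set of couplings of two Borel probability measures: probability measures on the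
product space whose first marginal is `P` and second marginal is `Q`. -/
def couplings {E : Type*} [MeasurableSpace E] (P Q : Measure E) : Set (Measure (E × E)) :=
  {γ | IsProbabilityMeasure γ ∧ γ.map Prod.fst = P ∧ γ.map Prod.snd = Q}

/-- `W_p^p(P,Q)`: the `p`-th power of the `p`-Wasserstein distance,
`inf_{γ ∈ Γ(P,Q)} ∫ ‖x - y‖^p dγ(x,y)`, as an extended nonnegative real. -/
def WpPow {E : Type*} [MeasurableSpace E] [NormedAddCommGroup E] (p : ℝ) (P Q : Measure E) :
    ℝ≥0∞ :=
  ⨅ γ ∈ couplings P Q, ∫⁻ z, ENNReal.ofReal (‖z.1 - z.2‖ ^ p) ∂γ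

/-- The `p`-Wasserstein distance `W_p(P,Q)`. -/
def Wp {E : Type*} [MeasurableSpace E] [NormedAddCommGroup E] (p : ℝ) (P Q : Measure E) :
    ℝ≥0∞ :=
  WpPow p P Q ^ (1 / p)

/-- Empirical distribution `n⁻¹ ∑ᵢ δ_{x i}` of `n` points. -/
def empDist {E : Type*} [MeasurableSpace E] {n : ℕ} (x : Fin n → E) : Measure E :=
  (n : ℝ≥0∞)⁻¹ • ∑ i, Measure.dirac (x i)

/-- The `n`-fold product measure `P^n` on `(ℝ^d)^n`. -/
def prodn {E : Type*} [MeasurableSpace E] (P : Measure E) (n : ℕ) : Measure (Fin n → E) :=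
  Measure.pi fun _ => P

/-- `P` has a finite moment of order `p`. -/
def HasFinMom {E : Type*} [MeasurableSpace E] [NormedAddCommGroup E] (p : ℝ) (P : Measure E) :
    Prop :=
  ∫⁻ x, ENNReal.ofReal (‖x‖ ^ p) ∂P ≠ ∞

open ProbabilityTheory

lemma cost_eq {E : Type*} [NormedAddCommGroup E] {p : ℝ} (hp : 1 ≤ p) (x : E) :
    ENNReal.ofReal (‖x‖ ^ p) = ‖x‖ₑ ^ p := by
  rw [← ENNReal.ofReal_rpow_of_nonneg (norm_nonneg _) (by linarith), ofReal_norm]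

lemma Wp_eq_iInf {d : ℕ} {p : ℝ} (hp : 1 ≤ p) (P Q : Measure (Euc d)) :
    Wp p P Q = ⨅ γ ∈ couplings P Q, (∫⁻ z, ‖z.1 - z.2‖ₑ ^ p ∂γ) ^ (1 / p) := by
  unfold Wp WpPow
  have hp' : 0 < 1 / p := by positivity
  simp_rw [cost_eq hp]
  have := fun x => ENNReal.orderIsoRpow_apply (1 / p) hp' x
  simp_rw [← this, OrderIso.map_iInf]

lemma exists_glue {d : ℕ} {A B C : Measure (Euc d)}
    {γ₁ γ₂ : Measure (Euc d × Euc d)}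
    (h₁ : γ₁ ∈ couplings A B) (h₂ : γ₂ ∈ couplings B C) :
    ∃ Γ : Measure (Euc d × (Euc d × Euc d)),
      Γ.map (fun z => (z.2.1, z.1)) = γ₁ ∧ Γ.map (fun z => (z.1, z.2.2)) = γ₂ := by
  obtain ⟨i₁, a₁, b₁⟩ := h₁
  obtain ⟨i₂, a₂, b₂⟩ := h₂
  have hB : IsProbabilityMeasure B := b₁ ▸ Measure.isProbabilityMeasure_map (by fun_prop)
  set ρ := γ₁.map Prod.swap with hρ
  have iρ : IsProbabilityMeasure ρ := Measure.isProbabilityMeasure_map (by fun_prop)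
  have hρf : ρ.fst = B := by
    rw [Measure.fst, hρ, Measure.map_map (by fun_prop) (by fun_prop)]
    exact b₁
  have e₁ : B ⊗ₘ ρ.condKernel = ρ := by
    rw [← hρf]; exact ρ.disintegrate ρ.condKernel
  have e₂ : B ⊗ₘ γ₂.condKernel = γ₂ := by
    have : γ₂.fst = B := a₂
    rw [← this]; exact γ₂.disintegrate γ₂.condKernel
  refine ⟨B ⊗ₘ (ρ.condKernel ×ₖ γ₂.condKernel), ?_, ?_⟩
  · have := Measure.compProd_map (μ := B) (κ := ρ.condKernel ×ₖ γ₂.condKernel)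
      (f := Prod.fst) measurable_fst
    rw [← Kernel.fst_eq, Kernel.fst_prod, e₁] at this
    have h := congrArg (Measure.map Prod.swap) this
    have h' : Measure.map Prod.swap ρ = γ₁ := by
      rw [hρ, Measure.map_map (by fun_prop) (by fun_prop), Prod.swap_swap_eq, Measure.map_id]
    rw [h', Measure.map_map (by fun_prop) (by fun_prop)] at h
    exact h.symm
  · have := Measure.compProd_map (μ := B) (κ := ρ.condKernel ×ₖ γ₂.condKernel)
      (f := Prod.snd) measurable_snd
    rw [← Kernel.snd_eq, Kernel.snd_prod, e₂] at this
    exact this.symm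

lemma Wp_triangle {d : ℕ} {p : ℝ} (hp : 1 ≤ p) (A B C : Measure (Euc d)) :
    Wp p A C ≤ Wp p A B + Wp p B C := by
  rw [Wp_eq_iInf hp A B, Wp_eq_iInf hp B C]
  simp_rw [ENNReal.iInf_add, ENNReal.add_iInf]
  refine le_iInf fun γ₁ => le_iInf fun h₁ => le_iInf fun γ₂ => le_iInf fun h₂ => ?_
  obtain ⟨Γ, g₁, g₂⟩ := exists_glue h₁ h₂
  rw [Wp_eq_iInf hp]
  obtain ⟨i₁, a₁, b₁⟩ := h₁
  obtain ⟨i₂, a₂, b₂⟩ := h₂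
  have m : Γ.map (fun z => (z.2.1, z.2.2)) ∈ couplings A C := by
    have x1 : (Γ.map (fun z => (z.2.1, z.2.2))).map Prod.fst = A := by
      rw [← a₁, ← g₁, Measure.map_map (by fun_prop) (by fun_prop),
        Measure.map_map (by fun_prop) (by fun_prop)]
      rfl
    refine ⟨?_, x1, ?_⟩
    · have hA : IsProbabilityMeasure A := a₁ ▸ Measure.isProbabilityMeasure_map (by fun_prop)
      rw [← x1] at hA
      exact Measure.isProbabilityMeasure_of_map Prod.fst
    · rw [← b₂, ← g₂, Measure.map_map (by fun_prop) (by fun_prop),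
        Measure.map_map (by fun_prop) (by fun_prop)]
      rfl
  refine (iInf₂_le _ m).trans ?_
  rw [← g₁, ← g₂, lintegral_map (by fun_prop) (by fun_prop),
    lintegral_map (by fun_prop) (by fun_prop), lintegral_map (by fun_prop) (by fun_prop)]
  refine le_trans ?_ (ENNReal.lintegral_Lp_add_le (by fun_prop) (by fun_prop) hp)
  gcongr with z
  simp only [Pi.add_apply]
  refine le_trans (le_of_eq ?_) (enorm_add_le _ _)
  congr 1
  abel

lemma Wp_comm {d : ℕ} {p : ℝ} (hp : 1 ≤ p) (A B : Measure (Euc d)) :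
    Wp p A B = Wp p B A := by
  have key : ∀ A B : Measure (Euc d), Wp p A B ≤ Wp p B A := by
    intro A B
    rw [Wp_eq_iInf hp, Wp_eq_iInf hp]
    refine le_iInf₂ fun γ h => ?_
    obtain ⟨i, a, b⟩ := h
    have m : γ.map Prod.swap ∈ couplings A B := by
      refine ⟨Measure.isProbabilityMeasure_map (by fun_prop), ?_, ?_⟩
      · rw [Measure.map_map (by fun_prop) (by fun_prop)]; exact b
      · rw [Measure.map_map (by fun_prop) (by fun_prop)]; exact a
    refine (iInf₂_le _ m).trans ?_
    rw [lintegral_map (by fun_prop) (by fun_prop)]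
    simp_rw [Prod.fst_swap, Prod.snd_swap, ← edist_eq_enorm_sub, edist_comm]
    rfl
  exact le_antisymm (key _ _) (key _ _)

lemma Wp_map_le {d : ℕ} {p : ℝ} (hp : 1 ≤ p) (A : Measure (Euc d)) [IsProbabilityMeasure A]
    (q : Euc d → Euc d) (hq : Measurable q) :
    Wp p A (A.map q) ≤ (∫⁻ x, ‖x - q x‖ₑ ^ p ∂A) ^ (1 / p) := by
  rw [Wp_eq_iInf hp]
  have m : A.map (fun x => (x, q x)) ∈ couplings A (A.map q) := by
    refine ⟨Measure.isProbabilityMeasure_map (by fun_prop), ?_, ?_⟩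
    · rw [Measure.map_map (by fun_prop) (by fun_prop)]; exact Measure.map_id
    · rw [Measure.map_map (by fun_prop) (by fun_prop)]; rfl
  refine (iInf₂_le _ m).trans ?_
  rw [lintegral_map (by fun_prop) (by fun_prop)]

lemma WpPow_add_le {d : ℕ} {p : ℝ} (hp : 1 ≤ p) (m α β : Measure (Euc d)) [IsFiniteMeasure α]
    [IsFiniteMeasure β] [IsFiniteMeasure m]
    [IsProbabilityMeasure (α + m)] [IsProbabilityMeasure (β + m)] (D : ℝ≥0∞)
    (hD : ∀ᵐ x ∂α, ∀ᵐ y ∂β, ‖x - y‖ₑ ^ p ≤ D) :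
    WpPow p (α + m) (β + m) ≤ D * α Set.univ := by
  have hr : α Set.univ = β Set.univ := by
    have h1 := measure_univ (μ := α + m)
    have h2 := measure_univ (μ := β + m)
    rw [Measure.add_apply] at h1 h2
    exact (ENNReal.add_left_inj (measure_ne_top m _)).1 (h1.trans h2.symm)
  set r := α Set.univ with hrd
  have hα : (r⁻¹ * r) • α = α := by
    by_cases h : r = 0
    · rw [Measure.measure_univ_eq_zero.1 h]; simp
    · rw [ENNReal.inv_mul_cancel h (measure_ne_top _ _), one_smul]
  have hβ : (r⁻¹ * r) • β = β := by
    by_cases h : r = 0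
    · rw [Measure.measure_univ_eq_zero.1 (hr.symm.trans h)]; simp
    · rw [ENNReal.inv_mul_cancel h (measure_ne_top _ _), one_smul]
  have x1 : (r⁻¹ • α.prod β + m.map (fun x => (x, x))).map Prod.fst = α + m := by
    rw [Measure.map_add _ _ (by fun_prop), Measure.map_smul,
      Measure.map_fst_prod, Measure.map_map (by fun_prop) (by fun_prop), ← hr, smul_smul, hα]
    congr 1
    exact Measure.map_id
  have x2 : (r⁻¹ • α.prod β + m.map (fun x => (x, x))).map Prod.snd = β + m := by
    rw [Measure.map_add _ _ (by fun_prop), Measure.map_smul,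
      Measure.map_snd_prod, Measure.map_map (by fun_prop) (by fun_prop), smul_smul, hβ]
    congr 1
    exact Measure.map_id
  have mem : r⁻¹ • α.prod β + m.map (fun x => (x, x)) ∈ couplings (α + m) (β + m) := by
    refine ⟨?_, x1, x2⟩
    have : IsProbabilityMeasure ((r⁻¹ • α.prod β + m.map (fun x => (x, x))).map Prod.fst) := by
      rw [x1]; infer_instance
    exact Measure.isProbabilityMeasure_of_map Prod.fst
  unfold WpPow
  refine (iInf₂_le _ mem).trans ?_
  simp_rw [cost_eq hp]
  rw [lintegral_add_measure, lintegral_smul_measure, lintegral_map (by fun_prop) (by fun_prop)]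
  have h0 : (0 : ℝ) < p := by linarith
  simp only [sub_self, enorm_zero, ENNReal.zero_rpow_of_pos h0, lintegral_zero, add_zero]
  rw [lintegral_prod _ (by fun_prop)]
  have : ∫⁻ x, ∫⁻ y, ‖x - y‖ₑ ^ p ∂β ∂α ≤ D * r * r := by
    calc _ ≤ ∫⁻ x, D * r ∂α := by
          refine lintegral_mono_ae ?_
          filter_upwards [hD] with x hx
          refine (lintegral_mono_ae hx).trans ?_
          simp [hr]
      _ = _ := by simp [hrd]
  refine (mul_le_mul_right this _).trans ?_
  by_cases h : r = 0
  · simp [h]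
  · rw [mul_comm, mul_assoc, ENNReal.mul_inv_cancel h (measure_ne_top _ _), mul_one]

lemma map_simple_eq {d : ℕ} (q : SimpleFunc (Euc d) (Euc d)) (A : Measure (Euc d)) :
    A.map q = ∑ s ∈ q.range, A (q ⁻¹' {s}) • Measure.dirac s := by
  classical
  ext S hS
  rw [Measure.map_apply q.measurable hS]
  simp only [Measure.coe_finsetSum, Finset.sum_apply, Measure.smul_apply, smul_eq_mul,
    Measure.dirac_apply' _ hS, Set.indicator_apply, Pi.one_apply, mul_ite, mul_one, mul_zero]
  rw [← Finset.sum_filter, sum_measure_preimage_singleton _ (fun y _ => q.measurableSet_fiber y)]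
  congr 1
  ext x
  simp

lemma Wp_simple_le {d : ℕ} {p : ℝ} (hp : 1 ≤ p) (q : SimpleFunc (Euc d) (Euc d)) :
    ∃ D : ℝ≥0∞, D ≠ ∞ ∧ ∀ (A B : Measure (Euc d)) [IsProbabilityMeasure A] [IsProbabilityMeasure B],
      WpPow p (A.map q) (B.map q) ≤ D * ∑ s ∈ q.range, (A (q ⁻¹' {s}) - B (q ⁻¹' {s})) := by
  classical
  refine ⟨∑ s ∈ q.range, ∑ t ∈ q.range, ‖s - t‖ₑ ^ p, ?_, ?_⟩
  · refine ENNReal.sum_ne_top.2 fun s _ => ENNReal.sum_ne_top.2 fun t _ => ?_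
    exact ENNReal.rpow_ne_top_of_nonneg (by linarith) enorm_ne_top
  intro A B _ _
  set m : Measure (Euc d) :=
    ∑ s ∈ q.range, min (A (q ⁻¹' {s})) (B (q ⁻¹' {s})) • Measure.dirac s with hm
  set α : Measure (Euc d) :=
    ∑ s ∈ q.range, (A (q ⁻¹' {s}) - B (q ⁻¹' {s})) • Measure.dirac s with hα
  set β : Measure (Euc d) :=
    ∑ s ∈ q.range, (B (q ⁻¹' {s}) - A (q ⁻¹' {s})) • Measure.dirac s with hβ
  have eA : A.map q = α + m := by
    rw [map_simple_eq, hα, hm, ← Finset.sum_add_distrib]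
    refine Finset.sum_congr rfl fun s _ => ?_
    rw [← add_smul, tsub_add_min]
  have eB : B.map q = β + m := by
    rw [map_simple_eq, hβ, hm, ← Finset.sum_add_distrib]
    refine Finset.sum_congr rfl fun s _ => ?_
    rw [← add_smul, min_comm, tsub_add_min]
  have iA : IsProbabilityMeasure (α + m) := by
    rw [← eA]; exact Measure.isProbabilityMeasure_map q.measurable.aemeasurable
  have iB : IsProbabilityMeasure (β + m) := by
    rw [← eB]; exact Measure.isProbabilityMeasure_map q.measurable.aemeasurable
  have fα : IsFiniteMeasure α := isFiniteMeasure_of_le (α + m) (Measure.le_add_right le_rfl)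
  have fm : IsFiniteMeasure m := isFiniteMeasure_of_le (α + m) (Measure.le_add_left le_rfl)
  have fβ : IsFiniteMeasure β := isFiniteMeasure_of_le (β + m) (Measure.le_add_right le_rfl)
  have rα : ∀ᵐ x ∂α, x ∈ q.range := by
    have : ∀ᵐ x ∂(A.map q), x ∈ q.range := by
      refine (ae_map_iff (p := fun x => x ∈ q.range) q.measurable.aemeasurable
        (q.range.measurableSet)).2 ?_
      exact ae_of_all _ fun x => q.mem_range_self x
    rw [eA, ae_add_measure_iff] at this
    exact this.1
  have rβ : ∀ᵐ x ∂β, x ∈ q.range := by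
    have : ∀ᵐ x ∂(B.map q), x ∈ q.range := by
      refine (ae_map_iff (p := fun x => x ∈ q.range) q.measurable.aemeasurable
        (q.range.measurableSet)).2 ?_
      exact ae_of_all _ fun x => q.mem_range_self x
    rw [eB, ae_add_measure_iff] at this
    exact this.1
  rw [eA, eB]
  refine (WpPow_add_le hp m α β (∑ s ∈ q.range, ∑ t ∈ q.range, ‖s - t‖ₑ ^ p) ?_).trans ?_
  · filter_upwards [rα] with x hx
    filter_upwards [rβ] with y hy
    exact (Finset.single_le_sum (f := fun t => ‖x - t‖ₑ ^ p) (fun _ _ => zero_le) hy).trans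
      (Finset.single_le_sum (f := fun s => ∑ t ∈ q.range, ‖s - t‖ₑ ^ p)
        (fun _ _ => zero_le) hx)
  · gcongr
    simp [hα]

lemma empDist_prob {d n : ℕ} (hn : n ≠ 0) (x : Fin n → Euc d) :
    IsProbabilityMeasure (empDist x) := by
  constructor
  simp [empDist]
  exact ENNReal.inv_mul_cancel (by exact_mod_cast hn) (by simp)

lemma lintegral_empDist {d n : ℕ} (x : Fin n → Euc d) (h : Euc d → ℝ≥0∞) (hh : Measurable h) :
    ∫⁻ y, h y ∂(empDist x) = (n : ℝ≥0∞)⁻¹ * ∑ i, h (x i) := by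
  rw [empDist, lintegral_smul_measure, lintegral_finsetSum_measure, smul_eq_mul]
  congr 1
  exact Finset.sum_congr rfl fun i _ => lintegral_dirac' _ hh

lemma markov_emp {d n : ℕ} (hn : n ≠ 0) (P : Measure (Euc d)) [IsProbabilityMeasure P]
    (h : Euc d → ℝ≥0∞) (hh : Measurable h) (c : ℝ≥0∞) (hc : c ≠ 0) (hc' : c ≠ ∞) :
    prodn P n {x | c ≤ ∫⁻ y, h y ∂(empDist x)} ≤ (∫⁻ y, h y ∂P) / c := by
  simp_rw [lintegral_empDist _ h hh]
  refine (meas_ge_le_lintegral_div (Measurable.aemeasurable (by fun_prop)) hc hc').trans ?_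
  gcongr
  rw [lintegral_const_mul _ (by fun_prop), lintegral_finsetSum _ (by fun_prop)]
  have : ∀ i : Fin n, ∫⁻ x, h (x i) ∂(prodn P n) = ∫⁻ y, h y ∂P := fun i =>
    (measurePreserving_eval (fun _ : Fin n => P) i).lintegral_comp hh
  simp_rw [this]
  simp only [Finset.sum_const, Finset.card_univ, Fintype.card_fin, nsmul_eq_mul]
  rw [← mul_assoc, ENNReal.inv_mul_cancel (by exact_mod_cast hn) (by simp), one_mul]

lemma cheb_emp {d n : ℕ} (hn : n ≠ 0) (P : Measure (Euc d)) [IsProbabilityMeasure P]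
    (A : Set (Euc d)) (hA : MeasurableSet A) (τ : ℝ) (hτ : 0 < τ) :
    prodn P n {x | ENNReal.ofReal τ < empDist x A - P A} ≤ ENNReal.ofReal (1 / (n * τ ^ 2)) := by
  have hn' : (0 : ℝ) < n := by positivity
  set f : Euc d → ℝ := A.indicator 1 with hf
  have hfm : Measurable f := measurable_one.indicator hA
  have hfb : ∀ y, f y ∈ Set.Icc (0 : ℝ) 1 := by
    intro y
    by_cases h : y ∈ A <;> simp [hf, h]
  have hL : MemLp f 2 P := MemLp.of_bound hfm.aestronglyMeasurable 1
    (ae_of_all _ fun y => by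
      rw [Real.norm_eq_abs, abs_of_nonneg (hfb y).1]; exact (hfb y).2)
  set S : (Fin n → Euc d) → ℝ := ∑ i, fun ω => f (ω i) with hS
  have hSL : MemLp S 2 (prodn P n) := by
    refine memLp_finsetSum' _ fun i _ => ?_
    exact hL.comp_measurePreserving (measurePreserving_eval (fun _ : Fin n => P) i)
  have hV : Var[S; prodn P n] ≤ n := by
    have h1 : Var[S; prodn P n] = ∑ i : Fin n, Var[f; P] :=
      variance_sum_pi (μ := fun _ : Fin n => P) (X := fun _ => f) (fun _ => hL)
    have h2 := variance_le_sq_of_bounded (μ := P) (ae_of_all _ hfb) hfm.aemeasurable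
    rw [h1]
    simp only [Finset.sum_const, Finset.card_univ, Fintype.card_fin, nsmul_eq_mul]
    nlinarith
  have hE : ∫ x, S x ∂(prodn P n) = n * P.real A := by
    have : ∀ i : Fin n, ∫ x, f (x i) ∂(prodn P n) = P.real A := fun i => by
      have h1 := integral_map (μ := prodn P n) (φ := Function.eval i) (f := f)
        (measurable_pi_apply i).aemeasurable hfm.aestronglyMeasurable
      rw [prodn, (measurePreserving_eval (fun _ : Fin n => P) i).map_eq, hf,
        integral_indicator_one hA] at h1
      exact h1.symm
    simp only [hS, Finset.sum_apply]
    rw [integral_finsetSum]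
    · simp [this]
    · intro i _
      exact (hL.comp_measurePreserving
        (measurePreserving_eval (fun _ : Fin n => P) i)).integrable (by norm_num)
  have iP : IsProbabilityMeasure (prodn P n) := by unfold prodn; infer_instance
  refine (measure_mono ?_).trans ((meas_ge_le_variance_div_sq hSL
    (show 0 < n * τ by positivity)).trans ?_)
  · intro x hx
    simp only [Set.mem_ofPred_eq] at hx ⊢
    rw [hE]
    have h1 : empDist x A = ENNReal.ofReal (S x / n) := by
      rw [← lintegral_indicator_one hA, lintegral_empDist _ _ (measurable_one.indicator hA),
        ENNReal.ofReal_div_of_pos hn', ENNReal.div_eq_inv_mul, ENNReal.ofReal_natCast, hS]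
      simp only [Finset.sum_apply]
      rw [ENNReal.ofReal_sum_of_nonneg (fun i _ => (hfb _).1)]
      congr 1
      refine Finset.sum_congr rfl fun i _ => ?_
      by_cases h : x i ∈ A <;> simp [hf, h]
    rw [h1, ← ofReal_measureReal, ← ENNReal.ofReal_sub _ measureReal_nonneg] at hx
    have h2 := (ENNReal.ofReal_lt_ofReal_iff_of_nonneg hτ.le).1 hx
    refine le_trans ?_ (le_abs_self _)
    have : τ * n < S x - P.real A * n := by
      have := mul_lt_mul_of_pos_right h2 hn'
      rwa [sub_mul, div_mul_cancel₀ _ hn'.ne'] at this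
    linarith
  · apply ENNReal.ofReal_le_ofReal
    calc _ ≤ (n : ℝ) / (n * τ) ^ 2 := by gcongr
      _ = _ := by field_simp

lemma exists_quant {d : ℕ} {p : ℝ} (hp : 1 ≤ p) (P : Measure (Euc d)) [IsProbabilityMeasure P]
    (hmom : HasFinMom p P) (δ : ℝ≥0∞) (hδ : δ ≠ 0) :
    ∃ q : SimpleFunc (Euc d) (Euc d), ∫⁻ x, ‖x - q x‖ₑ ^ p ∂P ≤ δ := by
  have h0 : 0 < p := by linarith
  have hp0 : ENNReal.ofReal p ≠ 0 := by simpa using h0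
  have hL : MemLp (id : Euc d → Euc d) (ENNReal.ofReal p) P := by
    refine ⟨aestronglyMeasurable_id, ?_⟩
    rw [eLpNorm_lt_top_iff_lintegral_rpow_enorm_lt_top hp0 ENNReal.ofReal_ne_top,
      ENNReal.toReal_ofReal h0.le]
    unfold HasFinMom at hmom
    simp_rw [cost_eq hp] at hmom
    exact hmom.lt_top
  obtain ⟨q, hq, -⟩ := hL.exists_simpleFunc_eLpNorm_sub_lt ENNReal.ofReal_ne_top
    (ε := δ ^ (1 / p)) (by
      intro h
      rcases ENNReal.rpow_eq_zero_iff.1 h with h | h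
      · exact hδ h.1
      · have : 0 < 1 / p := by positivity
        linarith [h.2])
  refine ⟨q, ?_⟩
  rw [eLpNorm_eq_lintegral_rpow_enorm_toReal hp0 ENNReal.ofReal_ne_top,
    ENNReal.toReal_ofReal h0.le] at hq
  exact ((ENNReal.rpow_lt_rpow_iff (by positivity)).1 hq).le

lemma Wp_emp_tendsto {d : ℕ} {p : ℝ} (hp : 1 ≤ p) (P : Measure (Euc d)) [IsProbabilityMeasure P]
    (hmom : HasFinMom p P) (e : ℝ≥0∞) (he : e ≠ 0) (he' : e ≠ ∞) :
    Tendsto (fun n : ℕ => prodn P n {x | e + e + e < Wp p (empDist x) P}) atTop (𝓝 0) := by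
  have h0 : 0 < p := by linarith
  have hep : e ^ p ≠ 0 := by
    intro h
    rcases ENNReal.rpow_eq_zero_iff.1 h with h | h
    · exact he h.1
    · exact he' h.1
  have hep' : e ^ p ≠ ∞ := ENNReal.rpow_ne_top_of_nonneg h0.le he'
  have hroot : (e ^ p) ^ (1 / p) = e := by
    rw [← ENNReal.rpow_mul, mul_one_div_cancel h0.ne', ENNReal.rpow_one]
  have h1p : 0 ≤ 1 / p := by positivity
  rw [ENNReal.tendsto_nhds_zero]
  intro θ hθ
  obtain ⟨q, hq⟩ := exists_quant hp P hmom (min (e ^ p) (θ / 2 * e ^ p)) (by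
    rw [← bot_eq_zero, ← bot_lt_iff_ne_bot, lt_min_iff, bot_lt_iff_ne_bot, bot_lt_iff_ne_bot]
    refine ⟨hep, mul_ne_zero ?_ hep⟩
    exact (ENNReal.half_pos hθ.ne').ne')
  obtain ⟨D, hD, hW⟩ := Wp_simple_le hp q
  obtain ⟨τ, hτ, hτD⟩ : ∃ τ : ℝ, 0 < τ ∧
      D * ∑ s ∈ q.range, ENNReal.ofReal τ ≤ e ^ p := by
    have ht : Tendsto (fun τ : ℝ => D * ∑ s ∈ q.range, ENNReal.ofReal τ) (𝓝[>] 0) (𝓝 0) := by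
      have hc : Continuous (fun τ : ℝ => D * ∑ s ∈ q.range, ENNReal.ofReal τ) := by
        refine (ENNReal.continuous_const_mul hD).comp ?_
        exact continuous_finsetSum _ fun _ _ => ENNReal.continuous_ofReal
      have := hc.tendsto 0
      simp only [ENNReal.ofReal_zero, Finset.sum_const_zero, mul_zero] at this
      exact this.mono_left nhdsWithin_le_nhds
    have h1 := (ENNReal.tendsto_nhds_zero.1 ht (e ^ p) (pos_iff_ne_zero.2 hep)).and
      self_mem_nhdsWithin
    obtain ⟨τ, h2, h3⟩ := h1.exists
    exact ⟨τ, h3, h2⟩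
  have hlim : Tendsto (fun n : ℕ => ∑ s ∈ q.range, ENNReal.ofReal (1 / (n * τ ^ 2))) atTop
      (𝓝 0) := by
    have h1 : Tendsto (fun n : ℕ => (1 : ℝ) / (n * τ ^ 2)) atTop (𝓝 0) := by
      refine Tendsto.div_atTop tendsto_const_nhds ?_
      exact tendsto_natCast_atTop_atTop.atTop_mul_const (by positivity)
    have h2 : Tendsto (fun n : ℕ => ∑ s ∈ q.range, ENNReal.ofReal (1 / (n * τ ^ 2))) atTop
        (𝓝 (∑ s ∈ q.range, ENNReal.ofReal 0)) :=
      tendsto_finsetSum _ fun _ _ => ENNReal.tendsto_ofReal h1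
    simpa using h2
  filter_upwards [ENNReal.tendsto_nhds_zero.1 hlim (θ / 2) (ENNReal.half_pos hθ.ne'),
    eventually_ne_atTop 0] with n hn hn0
  have hsub : {x : Fin n → Euc d | e + e + e < Wp p (empDist x) P} ⊆
      {x | e ^ p ≤ ∫⁻ y, ‖y - q y‖ₑ ^ p ∂(empDist x)} ∪
      ⋃ s ∈ q.range, {x | ENNReal.ofReal τ < empDist x (q ⁻¹' {s}) - P (q ⁻¹' {s})} := by
    intro x hx
    by_contra hcon
    rw [Set.mem_union, not_or] at hcon
    obtain ⟨c1, c2⟩ := hcon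
    simp only [Set.mem_ofPred_eq, not_le, Set.mem_iUnion, not_exists, not_lt] at c1 c2 hx
    have := empDist_prob hn0 x
    have t1 : Wp p (empDist x) ((empDist x).map q) ≤ e := by
      refine (Wp_map_le hp _ q q.measurable).trans ?_
      rw [← hroot]
      exact ENNReal.rpow_le_rpow c1.le h1p
    have t3 : Wp p (P.map q) P ≤ e := by
      rw [Wp_comm hp]
      refine (Wp_map_le hp _ q q.measurable).trans ?_
      rw [← hroot]
      exact ENNReal.rpow_le_rpow (hq.trans (min_le_left _ _)) h1p
    have t2 : Wp p ((empDist x).map q) (P.map q) ≤ e := by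
      rw [← hroot]
      refine ENNReal.rpow_le_rpow ((hW _ _).trans (le_trans ?_ hτD)) h1p
      gcongr with s hs
      exact c2 s hs
    refine absurd hx (not_lt.2 ?_)
    calc Wp p (empDist x) P
        ≤ Wp p (empDist x) (P.map q) + Wp p (P.map q) P := Wp_triangle hp _ _ _
      _ ≤ Wp p (empDist x) ((empDist x).map q) + Wp p ((empDist x).map q) (P.map q)
          + Wp p (P.map q) P := by gcongr; exact Wp_triangle hp _ _ _
      _ ≤ e + e + e := by gcongr
  calc _ ≤ _ := measure_mono hsub
    _ ≤ θ / 2 + θ / 2 := by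
      refine (measure_union_le _ _).trans (add_le_add ?_ ?_)
      · have hqm : Measurable q := q.measurable
        refine (markov_emp hn0 P _ (by fun_prop) _ hep hep').trans ?_
        refine ENNReal.div_le_of_le_mul (hq.trans (min_le_right _ _))
      · refine (measure_biUnion_finset_le _ _).trans (le_trans ?_ hn)
        exact Finset.sum_le_sum fun s _ => cheb_emp hn0 P _ (q.measurableSet_fiber s) τ hτ
    _ = θ := ENNReal.add_halves θ

lemma Wp_dirac_ne_top {d : ℕ} {p : ℝ} (hp : 1 ≤ p) (P : Measure (Euc d)) [IsProbabilityMeasure P]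
    (hmom : HasFinMom p P) : Wp p P (Measure.dirac 0) ≠ ∞ := by
  have h := Wp_map_le hp P (fun _ => 0) measurable_const
  rw [Measure.map_const, measure_univ, one_smul] at h
  refine ne_top_of_le_ne_top ?_ h
  refine ENNReal.rpow_ne_top_of_nonneg (by positivity) ?_
  unfold HasFinMom at hmom
  simp_rw [cost_eq hp] at hmom
  simpa using hmom

lemma WpPow_eq {d : ℕ} {p : ℝ} (hp : 1 ≤ p) (P Q : Measure (Euc d)) :
    WpPow p P Q = Wp p P Q ^ p := by
  rw [Wp, ← ENNReal.rpow_mul, one_div_mul_cancel (by linarith), ENNReal.rpow_one]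

/-- If `P` and `P₀` both have finite `p`-th moments, then
`T_n = W_p^p(P̂_n, P₀) → W_p^p(P, P₀)` in `Pⁿ`-probability: for every `ε > 0`,
`Pⁿ[|T_n - W_p^p(P,P₀)| > ε] → 0`.  (The absolute difference in `ℝ≥0∞` is expressed via
truncated subtraction as `(T_n - W) ⊔ (W - T_n)`.) -/
theorem empirical_Wasserstein_statistic_tendsto_in_probability {d : ℕ} (p : ℝ) (hp : 1 ≤ p)
    (P₀ P : Measure (Euc d)) [IsProbabilityMeasure P₀] [IsProbabilityMeasure P]
    (hmom₀ : HasFinMom p P₀) (hmom : HasFinMom p P) (ε : ℝ) (hε : 0 < ε) :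
    Tendsto (fun n : ℕ =>
        prodn P n {x |
          ENNReal.ofReal ε <
            (WpPow p (empDist x) P₀ - WpPow p P P₀) ⊔ (WpPow p P P₀ - WpPow p (empDist x) P₀)})
      atTop (𝓝 0) := by
  have hfin : Wp p P P₀ ≠ ∞ := by
    refine ne_top_of_le_ne_top ?_ (Wp_triangle hp P (Measure.dirac 0) P₀)
    rw [Wp_comm hp (Measure.dirac 0)]
    exact ENNReal.add_ne_top.2 ⟨Wp_dirac_ne_top hp P hmom, Wp_dirac_ne_top hp P₀ hmom₀⟩
  set W := Wp p P P₀ with hWd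
  have hWp : W ^ p ≠ ∞ := ENNReal.rpow_ne_top_of_nonneg (by linarith) hfin
  have hcont : Tendsto (fun t : ℝ≥0∞ => t ^ p) (𝓝 W) (𝓝 (W ^ p)) :=
    (ENNReal.continuous_rpow_const).tendsto W
  have hev := (ENNReal.tendsto_nhds hWp).1 hcont (ENNReal.ofReal ε) (ENNReal.ofReal_pos.2 hε)
  obtain ⟨η, hη, hηW⟩ := (ENNReal.hasBasis_nhds_of_ne_top hfin).eventually_iff.1 hev
  obtain ⟨e, he, he', hee⟩ : ∃ e : ℝ≥0∞, e ≠ 0 ∧ e ≠ ∞ ∧ e + e + e ≤ η := by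
    refine ⟨min η 1 / 3, ?_, ?_, ?_⟩
    · refine (ENNReal.div_pos ?_ (by simp)).ne'
      exact (lt_min hη one_pos).ne'
    · exact ENNReal.div_ne_top (ne_top_of_le_ne_top one_ne_top (min_le_right _ _)) (by simp)
    · rw [ENNReal.add_thirds]; exact min_le_left _ _
  refine tendsto_of_tendsto_of_tendsto_of_le_of_le tendsto_const_nhds
    (Wp_emp_tendsto hp P hmom e he he') (fun _ => zero_le) fun n => measure_mono ?_
  intro x hx
  simp only [Set.mem_ofPred_eq] at hx ⊢
  by_contra hcon
  rw [not_lt] at hcon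
  have hcon := hcon.trans hee
  have u1 : Wp p (empDist x) P₀ ≤ W + η := by
    refine (Wp_triangle hp _ P _).trans ?_
    rw [add_comm]
    gcongr
  have u2 : W - η ≤ Wp p (empDist x) P₀ := by
    rw [tsub_le_iff_left]
    refine (Wp_triangle hp _ (empDist x) _).trans ?_
    rw [Wp_comm hp P]
    gcongr
  have := hηW (x := Wp p (empDist x) P₀) ⟨u2, u1⟩
  rw [WpPow_eq hp, WpPow_eq hp, ← hWd] at hx
  refine absurd hx (not_lt.2 (sup_le ?_ ?_))
  · rw [tsub_le_iff_left]; exact this.2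
  · exact tsub_le_iff_tsub_le.1 this.1
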